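/- Let E be a real Banach space, D ⊊ E a domain, and α a c-cone arc (c ≥ 1) joining x, y ∈ D with arclength midpoint x₀. Then for any z₁, z₂ ∈ α[x,x₀] with z₂ ∈ α[z₁,x₀], the quasihyperbolic length of α[z₁,z₂] satisfies l_k(α[z₁,z₂]) ≤ 3c·log(1 + l(α[z₁,z₂])/Δ(z₁)) ≤ 3c·log(1 + c·Δ(z₂)/Δ(z₁)). -/

import Mathlib

open Set Metric

noncomputable section

variable {E : Type*} [NormedAddCommGroup E] [NormedSpace ℝ E]

/-- `deltaBd D z` is the distance `Δ(z)` from `z` to the boundary `∂D`. -/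
def deltaBd (D : Set E) (z : E) : ℝ := Metric.infDist z (frontier D)

/-- `γ` is a rectifiable curve in `D`, parametrized by (norm) arclength on `[0, L]`:
it maps `[0, L]` into `D` and the length of the subarc `γ[γ s, γ t]` equals `t - s`. -/
def IsArcLengthParam (D : Set E) (γ : ℝ → E) (L : ℝ) : Prop :=
  0 ≤ L ∧ (∀ t ∈ Icc (0 : ℝ) L, γ t ∈ D) ∧
    ∀ s t : ℝ, 0 ≤ s → s ≤ t → t ≤ L →
      eVariationOn γ (Icc s t) = ENNReal.ofReal (t - s)

/-- The quasihyperbolic length `l_k(γ[γ a, γ b]) = ∫ ds / Δ` of the subarc between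
parameters `a` and `b` of an arclength-parametrized curve `γ` in `D`. -/
def qhLength (D : Set E) (γ : ℝ → E) (a b : ℝ) : ℝ :=
  ∫ t in a..b, 1 / deltaBd D (γ t)

/-- The quasihyperbolic metric `k_D(x,y)`: the infimum of quasihyperbolic lengths of
rectifiable curves in `D` joining `x` and `y`. -/
def qhDist (D : Set E) (x y : E) : ℝ :=
  sInf { l : ℝ | ∃ γ : ℝ → E, ∃ L : ℝ, IsArcLengthParam D γ L ∧
    γ 0 = x ∧ γ L = y ∧ l = qhLength D γ 0 L }

/-- An arclength-parametrized curve `γ : [0,L] → D` joining `x = γ 0` and `y = γ L` is a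
`b`-cone arc if `min (l (γ[x,z])) (l (γ[z,y])) ≤ b * Δ z` for every point `z = γ t` on `γ`. -/
def IsConeArc (D : Set E) (γ : ℝ → E) (L b : ℝ) : Prop :=
  ∀ t ∈ Icc (0 : ℝ) L, min t (L - t) ≤ b * deltaBd D (γ t)

/-- `D` is a `c`-John domain: every pair of points of `D` can be joined by a `c`-cone arc. -/
def IsJohnDomain (D : Set E) (c : ℝ) : Prop :=
  ∀ x ∈ D, ∀ y ∈ D, ∃ γ : ℝ → E, ∃ L : ℝ,
    IsArcLengthParam D γ L ∧ γ 0 = x ∧ γ L = y ∧ IsConeArc D γ L c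

/-- A curve `γ` in `D` is a `c₀`-neargeodesic if `l_k(γ[x,y]) ≤ c₀ * k_D(x,y)` for all
points `x, y` on `γ`. -/
def IsNeargeodesic (D : Set E) (γ : ℝ → E) (L c₀ : ℝ) : Prop :=
  IsArcLengthParam D γ L ∧
    ∀ s t : ℝ, 0 ≤ s → s ≤ t → t ≤ L →
      qhLength D γ s t ≤ c₀ * qhDist D (γ s) (γ t)

/-- The Gromov product `(x|y)_p` with respect to the quasihyperbolic metric on `D`. -/
def gromovProd (D : Set E) (p x y : E) : ℝ :=
  (qhDist D x p + qhDist D y p - qhDist D x y) / 2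

/-- `(D, k_D)` is Gromov `δ`-hyperbolic. -/
def IsGromovHyperbolic (D : Set E) (δ : ℝ) : Prop :=
  ∀ x ∈ D, ∀ y ∈ D, ∀ z ∈ D, ∀ p ∈ D,
    min (gromovProd D p x y) (gromovProd D p y z) - δ ≤ gromovProd D p x z

end

/-- The distance to the boundary is positive at every point of a proper domain. -/
theorem deltaBd_pos {E : Type*} [NormedAddCommGroup E] [NormedSpace ℝ E] {D : Set E}
    (hD : IsOpen D) (hne : D ≠ Set.univ) {z : E} (hz : z ∈ D) : 0 < deltaBd D z := by
  have hfr : (frontier D).Nonempty := nonempty_frontier_iff.2 ⟨⟨z, hz⟩, hne⟩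
  refine (isClosed_frontier.notMem_iff_infDist_pos hfr).1 fun h => ?_
  rw [hD.frontier_eq] at h
  exact h.2 hz

/-- Arclength parametrizations are `1`-Lipschitz. -/
theorem IsArcLengthParam.dist_le {E : Type*} [NormedAddCommGroup E] [NormedSpace ℝ E]
    {D : Set E} {γ : ℝ → E} {L : ℝ} (hγ : IsArcLengthParam D γ L) {s t : ℝ}
    (hs : 0 ≤ s) (hst : s ≤ t) (ht : t ≤ L) : dist (γ s) (γ t) ≤ t - s := by
  have h := eVariationOn.edist_le γ (left_mem_Icc.2 hst) (right_mem_Icc.2 hst)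
  rw [hγ.2.2 s t hs hst ht, edist_dist] at h
  exact (ENNReal.ofReal_le_ofReal_iff (sub_nonneg.2 hst)).1 h

/-- On its first half, a cone arc satisfies the cone condition at arclength from its start. -/
theorem IsConeArc.le_mul_deltaBd {E : Type*} [NormedAddCommGroup E] [NormedSpace ℝ E]
    {D : Set E} {γ : ℝ → E} {L c : ℝ} (hγ : IsConeArc D γ L c) {t : ℝ}
    (h0 : 0 ≤ t) (ht : t ≤ L / 2) : t ≤ c * deltaBd D (γ t) := by
  have h := hγ t ⟨h0, by linarith⟩
  rwa [min_eq_left (by linarith)] at h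

/-- On the first half of a cone arc, `δ + u ≤ 3 c Δ`, where `δ` is the boundary distance at an
earlier point and `u` the arclength from that point. -/
theorem IsConeArc.deltaBd_add_le {E : Type*} [NormedAddCommGroup E] [NormedSpace ℝ E]
    {D : Set E} {γ : ℝ → E} {L c : ℝ} (hc : 1 ≤ c) (hγ : IsConeArc D γ L c)
    (hlen : IsArcLengthParam D γ L) {s t : ℝ} (hs : 0 ≤ s) (hst : s ≤ t) (ht : t ≤ L / 2) :
    deltaBd D (γ s) + (t - s) ≤ 3 * c * deltaBd D (γ t) := by
  have hcone := hγ.le_mul_deltaBd (hs.trans hst) ht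
  have hlip : deltaBd D (γ s) ≤ deltaBd D (γ t) + dist (γ s) (γ t) :=
    Metric.infDist_le_infDist_add_dist
  have hdist := hlen.dist_le hs hst (by linarith)
  have hnonneg : 0 ≤ deltaBd D (γ t) := Metric.infDist_nonneg
  nlinarith [mul_nonneg (sub_nonneg.2 hc) hnonneg]

theorem integral_div_add_sub_eq_mul_log {C δ s t : ℝ} (hδ : 0 < δ) (hst : s ≤ t) :
    ∫ τ in s..t, C / (δ + (τ - s)) = C * Real.log (1 + (t - s) / δ) := by
  have hshift : ∀ τ : ℝ, C / (δ + (τ - s)) = C * (τ + (δ - s))⁻¹ := fun τ => by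
    rw [div_eq_mul_inv]; ring_nf
  simp_rw [hshift]
  rw [intervalIntegral.integral_const_mul,
    intervalIntegral.integral_comp_add_right (fun τ => τ⁻¹),
    integral_inv_of_pos (by linarith) (by linarith)]
  congr 2
  have h : s + (δ - s) ≠ 0 := by linarith
  field_simp
  ring

/-- Let `D ⊊ E` be a domain and `α` a `c`-cone arc (`c ≥ 1`) joining
`x, y ∈ D` with arclength midpoint `x₀ = α (L/2)`. Then for any `z₁ = α s`, `z₂ = α t` on
`α[x, x₀]` with `z₂ ∈ α[z₁, x₀]`, the quasihyperbolic length of `α[z₁,z₂]` satisfies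
`l_k(α[z₁,z₂]) ≤ 3c * log (1 + l(α[z₁,z₂]) / Δ z₁) ≤ 3c * log (1 + c * Δ z₂ / Δ z₁)`.
(Here `l(α[z₁,z₂]) = t - s`.) -/
theorem cone_arc_first_half_qhLength_estimate
    {E : Type*} [NormedAddCommGroup E] [NormedSpace ℝ E] [CompleteSpace E]
    (D : Set E) (hD : IsOpen D) (hconn : IsConnected D) (hne : D ≠ Set.univ)
    (c : ℝ) (hc : 1 ≤ c) (α : ℝ → E) (L : ℝ) (x y : E)
    (hα : IsArcLengthParam D α L) (hx : α 0 = x) (hy : α L = y)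
    (hcone : IsConeArc D α L c)
    (s t : ℝ) (hs : 0 ≤ s) (hst : s ≤ t) (ht : t ≤ L / 2) :
    qhLength D α s t ≤ 3 * c * Real.log (1 + (t - s) / deltaBd D (α s)) ∧
    3 * c * Real.log (1 + (t - s) / deltaBd D (α s))
      ≤ 3 * c * Real.log (1 + c * deltaBd D (α t) / deltaBd D (α s)) := by
  have hpos : ∀ τ ∈ Icc s t, 0 < deltaBd D (α τ) := fun τ hτ =>
    deltaBd_pos hD hne (hα.2.1 τ ⟨hs.trans hτ.1, by linarith [hτ.2]⟩)
  have hδ := hpos s (left_mem_Icc.2 hst)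
  constructor
  · rw [← integral_div_add_sub_eq_mul_log hδ hst, qhLength,
      intervalIntegral.integral_of_le hst, intervalIntegral.integral_of_le hst]
    refine MeasureTheory.integral_mono_of_nonneg
      (Filter.Eventually.of_forall fun τ => one_div_nonneg.2 Metric.infDist_nonneg) ?_ ?_
    · refine (ContinuousOn.integrableOn_Icc ?_).mono_set Ioc_subset_Icc_self
      refine continuousOn_const.div (by fun_prop) fun τ hτ => ?_
      linarith [hτ.1]
    · refine (MeasureTheory.ae_restrict_mem measurableSet_Ioc).mono fun τ hτ => ?_
      have hτ' := Ioc_subset_Icc_self hτ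
      have h := hcone.deltaBd_add_le hc hα hs hτ'.1 (hτ'.2.trans ht)
      change 1 / deltaBd D (α τ) ≤ 3 * c / (deltaBd D (α s) + (τ - s))
      rw [div_le_div_iff₀ (hpos τ hτ') (by linarith [hτ'.1])]
      linarith
  · have h := hcone.le_mul_deltaBd (hs.trans hst) ht
    gcongr
    linarith
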